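/- arXiv:1406.1330 — 2 statements merged into one kernel-verified Lean document; each statement's English description precedes it below -/
import Mathlib

section
/- Let (V_n), (J_n) be sequences of matrix-valued functions on {(x,y) : x ≠ 0, y ≠ 0} and let (θ_n) satisfy the Lax pair D₂(θ_{n+1}) = V_n θ_n and D₁(θ_n) = −θ_{n+1} + J_n θ_n for all n, with every value θ_n(x,y) an invertible matrix. Then for all n and all x ≠ 0, y ≠ 0: (i) J_{n+1} + σ₁(θ_{n+1}θ_n⁻¹) − θ_{n+2}θ_{n+1}⁻¹ = ( D₁(θ_{n+1}θ_n⁻¹) + σ₁(θ_{n+1}θ_n⁻¹)·J_n )·θ_nθ_{n+1}⁻¹, and (ii) σ₂(θ_{n+2}θ_{n+1}⁻¹)·V_n·θ_nθ_{n+1}⁻¹ = V_{n+1} − D₂(θ_{n+2}θ_{n+1}⁻¹). -/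
/-- The q-shift homomorphism in `x` on matrix-valued functions. -/
noncomputable def msig1 (q α : ℝ) {m : ℕ} (f : ℝ → ℝ → Matrix (Fin m) (Fin m) ℂ) :
    ℝ → ℝ → Matrix (Fin m) (Fin m) ℂ :=
  fun x y => f (q ^ α * x) y

/-- The q-shift homomorphism in `y` on matrix-valued functions. -/
noncomputable def msig2 (q β : ℝ) {m : ℕ} (f : ℝ → ℝ → Matrix (Fin m) (Fin m) ℂ) :
    ℝ → ℝ → Matrix (Fin m) (Fin m) ℂ :=
  fun x y => f x (q ^ β * y)

/-- The q-difference operator in `x` on matrix-valued functions. -/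
noncomputable def mD1 (q α : ℝ) {m : ℕ} (f : ℝ → ℝ → Matrix (Fin m) (Fin m) ℂ) :
    ℝ → ℝ → Matrix (Fin m) (Fin m) ℂ :=
  fun x y => ((1 - q) * x)⁻¹ • (f x y - f (q ^ α * x) y)

/-- The q-difference operator in `y` on matrix-valued functions. -/
noncomputable def mD2 (q β : ℝ) {m : ℕ} (f : ℝ → ℝ → Matrix (Fin m) (Fin m) ℂ) :
    ℝ → ℝ → Matrix (Fin m) (Fin m) ℂ :=
  fun x y => ((1 - q) * y)⁻¹ • (f x y - f x (q ^ β * y))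

/-- If `J a = k (a - a') + b`, `J₁ b = k (b - b') + c`, then the
Darboux transform of the first potential satisfies its compatibility relation. -/
theorem darboux_first_identity {K R : Type*} [CommRing K] [Ring R] [Algebra K R] (k : K)
    {a b c a' b' ai bi ai' J J₁ : R} (ha : ai * a = 1) (hb : b * bi = 1) (ha' : ai' * a' = 1)
    (h : k • (a - a') = -b + J * a) (h₁ : k • (b - b') = -c + J₁ * b) :
    J₁ + b' * ai' - c * bi
      = (k • (b * ai - b' * ai') + b' * ai' * J) * (a * bi) := by
  have hJ : J * a = k • (a - a') + b := by rw [h]; abel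
  have hJ₁ : J₁ = (k • (b - b') + c) * bi := by
    rw [h₁, neg_add_cancel_comm, mul_assoc, hb, mul_one]
  calc J₁ + b' * ai' - c * bi
      = k • (b * bi - b' * bi) + b' * ai' := by
        rw [hJ₁, add_mul, smul_mul_assoc, sub_mul]; abel
    _ = k • (b * (ai * a) * bi - b' * ai' * a * bi)
          + b' * ai' * (k • (a - a') + b) * bi := by
        have e : b' * ai' * (k • (a - a') + b) * bi
            = k • (b' * ai' * a * bi - b' * (ai' * a') * bi) + b' * ai' * (b * bi) := by
          simp only [mul_add, add_mul, mul_smul_comm, smul_mul_assoc, mul_sub, sub_mul, mul_assoc]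
        rw [e, ha, ha', mul_one, mul_one, hb, mul_one, ← add_assoc, ← smul_add,
          sub_add_sub_cancel]
    _ = _ := by
        rw [← hJ]
        simp only [add_mul, smul_mul_assoc, sub_mul, mul_assoc]

/-- If `k (b - b') = V a` and `k (c - c') = V₁ b`, then the Darboux transform of the second
potential satisfies its compatibility relation. -/
theorem darboux_second_identity {K R : Type*} [CommRing K] [Ring R] [Algebra K R] (k : K)
    {a b c b' c' bi bi' V V₁ : R} (hb : b * bi = 1) (hb' : bi' * b' = 1)
    (h : k • (b - b') = V * a) (h₁ : k • (c - c') = V₁ * b) :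
    c' * bi' * V * (a * bi) = V₁ - k • (c * bi - c' * bi') := by
  have hV₁ : V₁ = k • (c - c') * bi := by rw [h₁, mul_assoc, hb, mul_one]
  calc c' * bi' * V * (a * bi)
      = c' * bi' * (V * a) * bi := by simp only [mul_assoc]
    _ = k • (c' * bi' * (b * bi) - c' * (bi' * b') * bi) := by
        rw [← h]
        simp only [mul_smul_comm, smul_mul_assoc, mul_sub, sub_mul, mul_assoc]
    _ = V₁ - k • (c * bi - c' * bi') := by
        rw [hV₁, hb, hb', mul_one, mul_one, smul_mul_assoc, ← smul_sub, sub_mul]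
        congr 1
        abel

/-- Two identities satisfied by the Darboux-transformed potentials `J̃_n`, `Ṽ_n`
of the noncommutative q-2DTL Lax pair. -/
theorem stmt_5 (q α β : ℝ) (hq : 0 < q) (hq1 : q ≠ 1) (m : ℕ) (hm : 1 ≤ m)
    (V J θ : ℤ → ℝ → ℝ → Matrix (Fin m) (Fin m) ℂ)
    (hθ2 : ∀ (n : ℤ) (x y : ℝ), x ≠ 0 → y ≠ 0 →
      mD2 q β (θ (n + 1)) x y = V n x y * θ n x y)
    (hθ1 : ∀ (n : ℤ) (x y : ℝ), x ≠ 0 → y ≠ 0 →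
      mD1 q α (θ n) x y = -θ (n + 1) x y + J n x y * θ n x y)
    (hθinv : ∀ (n : ℤ) (x y : ℝ), IsUnit (θ n x y)) :
    ∀ (n : ℤ) (x y : ℝ), x ≠ 0 → y ≠ 0 →
      (J (n + 1) x y + θ (n + 1) (q ^ α * x) y * (θ n (q ^ α * x) y)⁻¹
            - θ (n + 2) x y * (θ (n + 1) x y)⁻¹
          = (mD1 q α (fun u v => θ (n + 1) u v * (θ n u v)⁻¹) x y
              + θ (n + 1) (q ^ α * x) y * (θ n (q ^ α * x) y)⁻¹ * J n x y)
            * (θ n x y * (θ (n + 1) x y)⁻¹))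
        ∧ ((θ (n + 2) x (q ^ β * y) * (θ (n + 1) x (q ^ β * y))⁻¹)
              * V n x y * (θ n x y * (θ (n + 1) x y)⁻¹)
            = V (n + 1) x y
              - mD2 q β (fun u v => θ (n + 2) u v * (θ (n + 1) u v)⁻¹) x y) := by
  intro n x y hx hy
  have inv_mul (k : ℤ) (u v : ℝ) : (θ k u v)⁻¹ * θ k u v = 1 :=
    Matrix.nonsing_inv_mul _ ((Matrix.isUnit_iff_isUnit_det _).1 (hθinv k u v))
  have mul_inv (k : ℤ) (u v : ℝ) : θ k u v * (θ k u v)⁻¹ = 1 :=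
    Matrix.mul_nonsing_inv _ ((Matrix.isUnit_iff_isUnit_det _).1 (hθinv k u v))
  have hn : n + 1 + 1 = n + 2 := by ring
  have h1 := hθ1 (n + 1) x y hx hy
  have h2 := hθ2 (n + 1) x y hx hy
  rw [hn] at h1 h2
  exact ⟨darboux_first_identity _ (inv_mul _ _ _) (mul_inv _ _ _) (inv_mul _ _ _)
      (hθ1 n x y hx hy) h1,
    darboux_second_identity _ (mul_inv _ _ _) (inv_mul _ _ _) (hθ2 n x y hx hy) h2⟩
end

section
/- Let M be an invertible n×n matrix over R with n ≥ 2, fix indices i, j, and suppose the (n−1)×(n−1) submatrix M^{j,i} obtained from M by deleting row j and column i is invertible. Then the (i,j) entry of M⁻¹ is invertible in R and its inverse equals the quasideterminant of M about the (j,i) entry: ((M⁻¹)_{i,j})⁻¹ = m_{j,i} − r_j^i · (M^{j,i})⁻¹ · c_i^j, where r_j^i is row j of M with the i-th entry deleted and c_i^j is column i of M with the j-th entry deleted. -/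
open scoped Matrix


/-- The `(i,j)` entry of the inverse matrix is invertible and its inverse is
the quasideterminant of `M` about the `(j,i)` entry. -/
theorem stmt_13 {R : Type*} [Ring R] (n : ℕ) (hn : 1 ≤ n)
    (M Minv : Matrix (Fin (n + 1)) (Fin (n + 1)) R)
    (hMl : M * Minv = 1) (hMr : Minv * M = 1)
    (i j : Fin (n + 1))
    (Sinv : Matrix (Fin n) (Fin n) R)
    (hSl : M.submatrix j.succAbove i.succAbove * Sinv = 1)
    (hSr : Sinv * M.submatrix j.succAbove i.succAbove = 1) :
    IsUnit (Minv i j) ∧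
      Ring.inverse (Minv i j)
        = M j i - ∑ p : Fin n, ∑ q : Fin n,
            M j (i.succAbove p) * Sinv p q * M (j.succAbove q) i := by
  set S := M.submatrix j.succAbove i.succAbove
  set x := Minv i j
  let r : Fin n → R := fun p => M j (i.succAbove p)
  let c : Fin n → R := fun q => M (j.succAbove q) i
  let v : Fin n → R := fun p => Minv (i.succAbove p) j
  let w : Fin n → R := fun q => Minv i (j.succAbove q)
  have hsum : ∑ p : Fin n, ∑ q : Fin n,
      M j (i.succAbove p) * Sinv p q * M (j.succAbove q) i = r ⬝ᵥ Sinv *ᵥ c := by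
    simp only [dotProduct, Matrix.mulVec, Finset.mul_sum, mul_assoc, r, c]
  have hrv : M j i * x + r ⬝ᵥ v = 1 := by
    have h := congrFun₂ hMl j j
    rwa [Matrix.mul_apply, Fin.sum_univ_succAbove _ i, Matrix.one_apply_eq] at h
  have hSv : ∀ q, c q * x = -(S *ᵥ v) q := by
    intro q
    have h := congrFun₂ hMl (j.succAbove q) j
    rw [Matrix.mul_apply, Fin.sum_univ_succAbove _ i,
      Matrix.one_apply_ne (Fin.succAbove_ne j q)] at h
    exact eq_neg_of_add_eq_zero_left h
  have hwc : x * M j i + w ⬝ᵥ c = 1 := by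
    have h := congrFun₂ hMr i i
    rwa [Matrix.mul_apply, Fin.sum_univ_succAbove _ j, Matrix.one_apply_eq] at h
  have hwS : ∀ p, x * r p = -(w ᵥ* S) p := by
    intro p
    have h := congrFun₂ hMr i (i.succAbove p)
    rw [Matrix.mul_apply, Fin.sum_univ_succAbove _ j,
      Matrix.one_apply_ne (Fin.succAbove_ne i p).symm] at h
    exact eq_neg_of_add_eq_zero_left h
  have hright : (r ⬝ᵥ Sinv *ᵥ c) * x = -(r ⬝ᵥ v) := by
    calc (r ⬝ᵥ Sinv *ᵥ c) * x = (r ᵥ* Sinv) ⬝ᵥ (fun q => c q * x) := by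
          rw [Matrix.dotProduct_mulVec]
          simp only [dotProduct, Finset.sum_mul, mul_assoc]
      _ = (r ᵥ* Sinv) ⬝ᵥ (-(S *ᵥ v)) := by rw [funext hSv]; rfl
      _ = -(r ⬝ᵥ v) := by
          rw [dotProduct_neg, ← Matrix.dotProduct_mulVec, Matrix.mulVec_mulVec, hSr,
            Matrix.one_mulVec]
  have hleft : x * (r ⬝ᵥ Sinv *ᵥ c) = -(w ⬝ᵥ c) := by
    calc x * (r ⬝ᵥ Sinv *ᵥ c) = (fun p => x * r p) ⬝ᵥ (Sinv *ᵥ c) := by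
          simp only [dotProduct, Finset.mul_sum, mul_assoc]
      _ = (-(w ᵥ* S)) ⬝ᵥ (Sinv *ᵥ c) := by rw [funext hwS]; rfl
      _ = -(w ⬝ᵥ c) := by
          rw [neg_dotProduct, ← Matrix.dotProduct_mulVec, Matrix.mulVec_mulVec, hSl,
            Matrix.one_mulVec]
  rw [hsum]
  let u : Rˣ :=
    { val := x
      inv := M j i - r ⬝ᵥ Sinv *ᵥ c
      val_inv := by rw [mul_sub, hleft, sub_neg_eq_add, hwc]
      inv_val := by rw [sub_mul, hright, sub_neg_eq_add, hrv] }
  exact ⟨u.isUnit, Ring.inverse_unit u⟩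
end
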